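/- Fix an alphabet size d ≥ 1 and a constant C ≥ 1. For every ε ∈ (0,1), every δ ∈ (0,1), and every finite set 𝒲 of words over {1,…,d}, there exists N₀ ∈ ℕ such that for all N ≥ N₀ and every matrix H ∈ ℝ^{N×N} with H Hᵀ = N·I_N whose entries are bounded in absolute value by C, the Walsh–Hadamard random model built from H satisfies P( |(1/N)⟨A_I h₀, A_J h₀⟩ − δ_{I,J}| ≤ ε for all I, J ∈ 𝒲 ) ≥ 1 − δ. -/

import Mathlib

open MeasureTheory ProbabilityTheory Matrix

noncomputable section

/-- Ordered product of the matrices `A i` along the word `I`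
(the identity matrix for the empty word). -/
def wordProd {d : ℕ} {n : Type*} [Fintype n] [DecidableEq n]
    (A : Fin d → Matrix n n ℝ) (I : List (Fin d)) : Matrix n n ℝ :=
  (I.map A).prod

/-- Kronecker delta of two words: `1` if `I = J`, `0` otherwise. -/
def wordDelta {d : ℕ} (I J : List (Fin d)) : ℝ := if I = J then 1 else 0

/-- Sample space of the Walsh–Hadamard random model: the diagonal vectors
`Δ^1, …, Δ^d ∈ ℝ^N` and the initial vector `h₀ ∈ ℝ^N`. -/
abbrev WHOmega (d N : ℕ) : Type :=
  (Fin d → Fin N → ℝ) × (Fin N → ℝ)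

/-- The probability measure of the Walsh–Hadamard random model: all entries of the
vectors `Δ^i` are i.i.d. standard Gaussians, and the entries of `h₀` are i.i.d.
standard Gaussians, independent of the `Δ^i`. -/
def whMeasure (d N : ℕ) : Measure (WHOmega d N) :=
  (Measure.pi fun _ : Fin d => Measure.pi fun _ : Fin N => gaussianReal 0 1).prod
    (Measure.pi fun _ : Fin N => gaussianReal 0 1)

/-- The channel matrices of the Walsh–Hadamard model: `A^i = (1/√N) H diag(Δ^i)`. -/
def whA {d N : ℕ} (H : Matrix (Fin N) (Fin N) ℝ) (ω : WHOmega d N) (i : Fin d) :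
    Matrix (Fin N) (Fin N) ℝ :=
  (Real.sqrt N)⁻¹ • (H * Matrix.diagonal (ω.1 i))

/-- The random feature `A_I h₀` associated to a word `I`. -/
def whFeature {d N : ℕ} (H : Matrix (Fin N) (Fin N) ℝ) (I : List (Fin d))
    (ω : WHOmega d N) : Fin N → ℝ :=
  (wordProd (whA H ω) I).mulVec ω.2

/-- The moments of the standard Gaussian. -/
def gaussMoment (k : ℕ) : ℝ := ∫ x, x ^ k ∂(gaussianReal 0 1)

lemma integrable_pow_gaussianReal (k : ℕ) :
    Integrable (fun x : ℝ => x ^ k) (gaussianReal 0 1) := by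
  have h : Integrable (fun x : ℝ => ‖id x‖ ^ k) (gaussianReal 0 1) :=
    (memLp_id_gaussianReal (k : NNReal)).integrable_norm_pow'
  refine h.mono' (by fun_prop) (Filter.Eventually.of_forall fun x => ?_)
  simp

lemma gaussMoment_zero : gaussMoment 0 = 1 := by simp [gaussMoment]

lemma gaussMoment_one : gaussMoment 1 = 0 := by
  simp [gaussMoment, integral_id_gaussianReal]

lemma gaussMoment_two : gaussMoment 2 = 1 := by
  have h := variance_fun_id_gaussianReal (μ := 0) (v := 1)
  rw [variance_eq_integral (by fun_prop)] at h
  simpa [gaussMoment, integral_id_gaussianReal] using h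

lemma exists_abs_gaussMoment_le_pow (n : ℕ) :
    ∃ B : ℝ, 1 ≤ B ∧ ∀ k ≤ n, |gaussMoment k| ≤ B ^ k := by
  refine ⟨1 + ∑ k ∈ Finset.range (n + 1), |gaussMoment k|, ?_, fun k hk => ?_⟩
  · linarith [Finset.sum_nonneg fun k (_ : k ∈ Finset.range (n + 1)) => abs_nonneg (gaussMoment k)]
  · have h1 : |gaussMoment k| ≤ ∑ k ∈ Finset.range (n + 1), |gaussMoment k| :=
      Finset.single_le_sum (f := fun k => |gaussMoment k|) (fun _ _ => abs_nonneg _)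
        (Finset.mem_range.2 (by omega))
    rcases Nat.eq_zero_or_pos k with rfl | hk0
    · simp [gaussMoment_zero]
    · refine le_trans ?_ (le_self_pow₀ ?_ hk0.ne')
      · linarith
      · linarith [abs_nonneg (gaussMoment k)]

section Matchings

variable {P L A : Type*} [Fintype P] [Fintype L] [DecidableEq A]

/-- The expectation of `∏ ℓ, ∏ x ∈ lab ℓ, g ℓ (p x)` for i.i.d. standard Gaussians `g ℓ a`. -/
def labelMoment [Fintype A] (lab : L → Finset P) (p : P → A) : ℝ :=
  ∏ ℓ, ∏ a, gaussMoment {x ∈ lab ℓ | p x = a}.card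

/-- The perfect matchings of `P`, as fixed-point-free involutions, which preserve the labels. -/
def matchings [DecidableEq P] (lab : L → Finset P) : Finset (P → P) :=
  {τ | (∀ x, τ (τ x) = x) ∧ (∀ x, τ x ≠ x) ∧ ∀ ℓ x, τ x ∈ lab ℓ ↔ x ∈ lab ℓ}

omit [DecidableEq A] in
lemma exists_abs_labelMoment_le (lab : L → Finset P) :
    ∃ B : ℝ, ∀ (A : Type) [Fintype A] [DecidableEq A] (p : P → A), |labelMoment lab p| ≤ B := by
  obtain ⟨B, hB, h⟩ := exists_abs_gaussMoment_le_pow (Fintype.card P)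
  refine ⟨∏ ℓ, B ^ (lab ℓ).card, fun A _ _ p => ?_⟩
  rw [labelMoment, Finset.abs_prod]
  refine Finset.prod_le_prod (fun _ _ => abs_nonneg _) fun ℓ _ => ?_
  rw [Finset.abs_prod, Finset.card_eq_sum_card_fiberwise (t := Finset.univ) (f := p)
    (fun _ _ => Finset.mem_coe.2 (Finset.mem_univ _)), ← Finset.prod_pow_eq_pow_sum]
  exact Finset.prod_le_prod (fun _ _ => abs_nonneg _) fun a _ =>
    h _ (Finset.card_le_univ _)

lemma two_mul_card_image_lt {p : P → A} (h : ∀ x, ∃ y, p y = p x ∧ y ≠ x)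
    {x y z : P} (hy : p y = p x) (hz : p z = p x) (hyx : y ≠ x) (hzx : z ≠ x) (hyz : y ≠ z) :
    2 * (Finset.univ.image p).card < Fintype.card P := by
  rw [← Finset.card_univ, Finset.card_eq_sum_card_image p, mul_comm, ← smul_eq_mul,
    ← Finset.sum_const]
  refine Finset.sum_lt_sum (fun a ha => ?_) ⟨p x, by simp, ?_⟩
  · obtain ⟨x, -, rfl⟩ := Finset.mem_image.1 ha
    obtain ⟨y, hy, hne⟩ := h x
    exact Finset.one_lt_card.2 ⟨y, by simp [hy], x, by simp, hne⟩
  · exact Finset.two_lt_card.2 ⟨x, by simp, y, by simp [hy], z, by simp [hz], hyx.symm,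
      hzx.symm, hyz⟩

omit [Fintype P] in
lemma labelMoment_eq_zero [Fintype A] {lab : L → Finset P} {p : P → A} {ℓ : L} {x : P}
    (hx : x ∈ lab ℓ) (h : ∀ y ∈ lab ℓ, p y = p x → y = x) : labelMoment lab p = 0 := by
  refine Finset.prod_eq_zero (Finset.mem_univ ℓ) (Finset.prod_eq_zero (Finset.mem_univ (p x)) ?_)
  have : {y ∈ lab ℓ | p y = p x} = {x} := by
    ext y
    simp only [Finset.mem_filter, Finset.mem_singleton]
    exact ⟨fun hy => h y hy.1 hy.2, fun hy => by subst hy; exact ⟨hx, rfl⟩⟩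
  rw [this, Finset.card_singleton, gaussMoment_one]

lemma labelMoment_eq_one [DecidableEq P] [Fintype A] {lab : L → Finset P} {p : P → A}
    {τ : P → P} (hτ : τ ∈ matchings lab)
    (hp : ∀ x, p (τ x) = p x) (h : ∀ x y, p y = p x → y = x ∨ y = τ x) :
    labelMoment lab p = 1 := by
  obtain ⟨-, h2, h3⟩ := (Finset.mem_filter.1 hτ).2
  refine Finset.prod_eq_one fun ℓ _ => Finset.prod_eq_one fun a _ => ?_
  rcases Finset.eq_empty_or_nonempty {x ∈ lab ℓ | p x = a} with he | ⟨x, hx⟩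
  · rw [he, Finset.card_empty, gaussMoment_zero]
  · obtain ⟨hxℓ, rfl⟩ := Finset.mem_filter.1 hx
    have : {y ∈ lab ℓ | p y = p x} = {x, τ x} := by
      ext y
      simp only [Finset.mem_filter, Finset.mem_singleton, Finset.mem_insert]
      refine ⟨fun hy => h x y hy.2, ?_⟩
      rintro (rfl | rfl)
      · exact ⟨hxℓ, rfl⟩
      · exact ⟨(h3 ℓ x).2 hxℓ, hp x⟩
    rw [this, Finset.card_pair (h2 x).symm, gaussMoment_two]

/-- Wick's formula for index maps taking sufficiently many values. -/
lemma labelMoment_eq_sum_matchings [DecidableEq P] [Fintype A] {lab : L → Finset P}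
    (hlab : ∀ x, ∃ ℓ, x ∈ lab ℓ) {p : P → A}
    (hp : Fintype.card P ≤ 2 * (Finset.univ.image p).card) :
    labelMoment lab p = ∑ τ ∈ matchings lab, if ∀ x, p (τ x) = p x then 1 else 0 := by
  by_cases h : ∀ x, ∃ y, p y = p x ∧ y ≠ x
  · choose τ hτp hτ using h
    have huniq : ∀ x y, p y = p x → y = x ∨ y = τ x := fun x y hy => by
      by_contra! hne
      exact absurd (two_mul_card_image_lt (fun x => ⟨τ x, hτp x, hτ x⟩) hy (hτp x) hne.1 (hτ x)
        hne.2) (by omega)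
    have heq : ∀ σ ∈ matchings lab, (∀ x, p (σ x) = p x) → σ = τ := fun σ hσ h => by
      obtain ⟨-, h2, -⟩ := (Finset.mem_filter.1 hσ).2
      exact funext fun x => (huniq x _ (h x)).resolve_left (h2 x)
    by_cases hmem : τ ∈ matchings lab
    · rw [labelMoment_eq_one hmem hτp huniq, Finset.sum_eq_single_of_mem τ hmem, if_pos hτp]
      exact fun σ hσ hne => if_neg fun h => hne (heq σ hσ h)
    · rw [Finset.sum_eq_zero fun σ hσ => if_neg fun h => hmem (heq σ hσ h ▸ hσ)]
      have hinv : ∀ x, τ (τ x) = x := fun x =>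
        (((huniq (τ x) x (hτp x).symm)).resolve_left (hτ x).symm).symm
      have : ¬ ∀ ℓ x, τ x ∈ lab ℓ ↔ x ∈ lab ℓ := fun h3 =>
        hmem (Finset.mem_filter.2 ⟨Finset.mem_univ _, hinv, hτ, h3⟩)
      have : ∃ ℓ x, x ∈ lab ℓ ∧ τ x ∉ lab ℓ := by
        by_contra! hcon
        exact this fun ℓ x => ⟨fun hx => hinv x ▸ hcon ℓ _ hx, hcon ℓ x⟩
      obtain ⟨ℓ, x, hx, hx'⟩ := this
      exact labelMoment_eq_zero hx fun y hy hyx =>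
        (huniq x y hyx).resolve_right fun h => hx' (h ▸ hy)
  · push Not at h
    obtain ⟨x, hx⟩ := h
    obtain ⟨ℓ, hℓ⟩ := hlab x
    rw [labelMoment_eq_zero hℓ fun y _ hy => hx y hy, Finset.sum_eq_zero]
    intro τ hτ
    obtain ⟨-, h2, -⟩ := (Finset.mem_filter.1 hτ).2
    exact if_neg fun h => h2 x (hx _ (h x))

lemma card_filter_card_image_le [DecidableEq P] [Fintype A] [Nonempty A] (s : ℕ) :
    Finset.card {p : P → A | (Finset.univ.image p).card ≤ s} ≤
      s ^ Fintype.card P * Fintype.card A ^ s := by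
  classical
  calc _ ≤ (Finset.univ.image fun fg : (P → Fin s) × (Fin s → A) => fg.2 ∘ fg.1).card := by
        refine Finset.card_le_card fun p hp => ?_
        replace hp := (Finset.mem_filter.1 hp).2
        have : Fintype.card (Finset.univ.image p) ≤ Fintype.card (Fin s) := by
          rwa [Fintype.card_coe, Fintype.card_fin]
        obtain ⟨e⟩ := Function.Embedding.nonempty_of_card_le this
        refine Finset.mem_image.2 ⟨⟨fun x => e ⟨p x, by simp⟩, fun j =>
          Function.extend e Subtype.val (fun _ => Classical.arbitrary A) j⟩, Finset.mem_univ _, ?_⟩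
        funext x
        simp [e.injective.extend_apply]
    _ ≤ _ := Finset.card_image_le.trans (by simp [Finset.card_univ])

end Matchings

section GraphSum

variable {P ℰ : Type*} [Fintype P] [DecidableEq P] [Fintype ℰ] [DecidableEq ℰ] {N : ℕ}

/-- The index maps which are constant on the orbits of `τ`. -/
def invariantMaps (N : ℕ) (τ : P → P) : Finset (P → Fin N) := {p | ∀ x, p (τ x) = p x}

/-- The product of the entries of `H` along the edges in `F`. -/
def edgeWeight (H : Matrix (Fin N) (Fin N) ℝ) (src dst : ℰ → P) (F : Finset ℰ) (p : P → Fin N) :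
    ℝ :=
  ∏ e ∈ F, H (p (src e)) (p (dst e))

omit [Fintype P] [DecidableEq P] [DecidableEq ℰ] in
lemma abs_edgeWeight_le {H : Matrix (Fin N) (Fin N) ℝ} {C : ℝ} (hC : 1 ≤ C)
    (hH : ∀ α β, |H α β| ≤ C) (src dst : ℰ → P) (F : Finset ℰ) (p : P → Fin N) :
    |edgeWeight H src dst F p| ≤ C ^ Fintype.card ℰ := by
  rw [edgeWeight, Finset.abs_prod]
  calc _ ≤ ∏ _e ∈ F, C := Finset.prod_le_prod (fun _ _ => abs_nonneg _) fun _ _ => hH _ _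
    _ = C ^ F.card := Finset.prod_const _
    _ ≤ _ := pow_le_pow_right₀ hC (Finset.card_le_univ _)

lemma sum_invariantMaps_resample {τ : P → P} (hτ : ∀ x, τ (τ x) = x) (x : P)
    (f : (P → Fin N) → ℝ) :
    N * ∑ p ∈ invariantMaps N τ, f p =
      ∑ p ∈ invariantMaps N τ, ∑ a, f fun z => if z = x ∨ z = τ x then a else p z := by
  rw [Finset.mul_sum, ← Finset.sum_product']
  trans ∑ pa ∈ invariantMaps N τ ×ˢ (Finset.univ : Finset (Fin N)), f pa.1
  · simp [Finset.sum_product]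
  have hmem : ∀ pa ∈ invariantMaps N τ ×ˢ (Finset.univ : Finset (Fin N)),
      ((fun z => if z = x ∨ z = τ x then pa.2 else pa.1 z, pa.1 x) : (P → Fin N) × Fin N) ∈
        invariantMaps N τ ×ˢ (Finset.univ : Finset (Fin N)) := by
    intro pa hpa
    have hpa := (Finset.mem_filter.1 (Finset.mem_product.1 hpa).1).2
    refine Finset.mem_product.2 ⟨Finset.mem_filter.2 ⟨Finset.mem_univ _, fun z => ?_⟩,
      Finset.mem_univ _⟩
    have h1 : τ z = x ↔ z = τ x := ⟨fun h => by rw [← h, hτ], fun h => by rw [h, hτ]⟩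
    have h2 : τ z = τ x ↔ z = x := ⟨fun h => by rw [← hτ z, h, hτ], fun h => by rw [h]⟩
    simp only [h1, h2, or_comm, hpa]
  have hinv : ∀ pa ∈ invariantMaps N τ ×ˢ (Finset.univ : Finset (Fin N)),
      ((fun z => if z = x ∨ z = τ x then pa.1 x else
        (fun z => if z = x ∨ z = τ x then pa.2 else pa.1 z) z,
        (fun z => if z = x ∨ z = τ x then pa.2 else pa.1 z) x) : (P → Fin N) × Fin N) = pa := by
    intro pa hpa
    have hpa := (Finset.mem_filter.1 (Finset.mem_product.1 hpa).1).2
    refine Prod.ext (funext fun z => ?_) (by simp)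
    by_cases h : z = x ∨ z = τ x
    · rcases h with rfl | rfl
      · simp
      · simp [hpa]
    · simp [h]
  refine Finset.sum_nbij'
    (fun pa => (fun z => if z = x ∨ z = τ x then pa.2 else pa.1 z, pa.1 x))
    (fun pa => (fun z => if z = x ∨ z = τ x then pa.2 else pa.1 z, pa.1 x))
    hmem hmem hinv hinv fun pa hpa => ?_
  exact congrArg f (congrArg Prod.fst (hinv pa hpa)).symm

omit [Fintype ℰ] in
/-- Summing over the common source of two edges by column orthogonality of `H`. -/
lemma sum_edgeWeight_insert_insert {H : Matrix (Fin N) (Fin N) ℝ} (hN : N ≠ 0)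
    (hH : Hᵀ * H = (N : ℝ) • (1 : Matrix (Fin N) (Fin N) ℝ)) {τ : P → P}
    (hτ : ∀ x, τ (τ x) = x) {src dst : ℰ → P} {F : Finset ℰ} {e₁ e₂ : ℰ}
    (h12 : e₁ ≠ e₂) (h1 : e₁ ∉ F) (h2 : e₂ ∉ F) (hsrc : src e₂ = τ (src e₁))
    (hd1 : dst e₁ ≠ src e₁ ∧ dst e₁ ≠ τ (src e₁)) (hd2 : dst e₂ ≠ src e₁ ∧ dst e₂ ≠ τ (src e₁))
    (hF : ∀ e ∈ F, (src e ≠ src e₁ ∧ src e ≠ τ (src e₁)) ∧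
      (dst e ≠ src e₁ ∧ dst e ≠ τ (src e₁))) :
    ∑ p ∈ invariantMaps N τ, edgeWeight H src dst (insert e₁ (insert e₂ F)) p =
      ∑ p ∈ invariantMaps N τ,
        if p (dst e₁) = p (dst e₂) then edgeWeight H src dst F p else 0 := by
  have hN' : (N : ℝ) ≠ 0 := Nat.cast_ne_zero.2 hN
  refine mul_left_cancel₀ hN' ?_
  rw [sum_invariantMaps_resample hτ (src e₁), Finset.mul_sum]
  refine Finset.sum_congr rfl fun p _ => ?_
  have horth : ∀ b c, ∑ a, H a b * H a c = if b = c then (N : ℝ) else 0 := fun b c => by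
    have := congrFun (congrFun hH b) c
    simpa [Matrix.mul_apply, Matrix.one_apply] using this
  have hw : ∀ a, edgeWeight H src dst F
      (fun z => if z = src e₁ ∨ z = τ (src e₁) then a else p z) = edgeWeight H src dst F p :=
    fun a => Finset.prod_congr rfl fun e he => by
      obtain ⟨⟨h3, h4⟩, h5, h6⟩ := hF e he
      simp [h3, h4, h5, h6]
  have : ∀ a, edgeWeight H src dst (insert e₁ (insert e₂ F))
      (fun z => if z = src e₁ ∨ z = τ (src e₁) then a else p z) =
      H a (p (dst e₁)) * H a (p (dst e₂)) * edgeWeight H src dst F p := fun a => by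
    rw [edgeWeight, Finset.prod_insert (by simp [h12, h1]), Finset.prod_insert h2, ← mul_assoc]
    congr 1
    · simp [hsrc, hd1, hd2]
    · exact hw a
  simp_rw [this, ← Finset.sum_mul, horth]
  split_ifs <;> simp

lemma card_filter_two_mul_card_image_lt_le (hN : N ≠ 0) :
    (Finset.card {p : P → Fin N | 2 * (Finset.univ.image p).card < Fintype.card P} : ℝ) ≤
      (((Fintype.card P - 1) / 2) ^ Fintype.card P : ℕ) * (N : ℝ) ^ ((Fintype.card P - 1) / 2) := by
  have : Nonempty (Fin N) := ⟨⟨0, Nat.pos_of_ne_zero hN⟩⟩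
  have h := card_filter_card_image_le (P := P) (A := Fin N) ((Fintype.card P - 1) / 2)
  rw [Fintype.card_fin] at h
  refine le_trans (Nat.cast_le.2 (Finset.card_le_card ?_)) (by exact_mod_cast h)
  intro p hp
  simp only [Finset.mem_filter, Finset.mem_univ, true_and] at hp ⊢
  omega

/-- A sum over the index maps with few values is negligible. -/
lemma abs_sum_le_of_two_mul_card_image_lt (hN : N ≠ 0) {B : ℝ} (hB : 0 ≤ B)
    (S : Finset (P → Fin N)) (f : (P → Fin N) → ℝ) (hf : ∀ p, |f p| ≤ B)
    (h0 : ∀ p ∈ S, Fintype.card P ≤ 2 * (Finset.univ.image p).card → f p = 0) :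
    |∑ p ∈ S, f p| ≤ B * (((Fintype.card P - 1) / 2) ^ Fintype.card P : ℕ) *
      (N : ℝ) ^ ((Fintype.card P - 1) / 2) := by
  rw [← Finset.sum_filter_of_ne (p := fun p => 2 * (Finset.univ.image p).card < Fintype.card P)
    fun p hp hne => not_le.1 fun hle => hne (h0 p hp hle)]
  calc _ ≤ ∑ p ∈ S with 2 * (Finset.univ.image p).card < Fintype.card P, |f p| :=
        Finset.abs_sum_le_sum_abs _ _
    _ ≤ ∑ p : P → Fin N with 2 * (Finset.univ.image p).card < Fintype.card P, B :=
        (Finset.sum_le_sum fun p _ => hf p).trans (Finset.sum_le_sum_of_subset_of_nonneg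
          (Finset.filter_subset_filter _ (Finset.subset_univ _)) fun _ _ _ => hB)
    _ = B * Finset.card {p : P → Fin N | 2 * (Finset.univ.image p).card < Fintype.card P} := by
        rw [Finset.sum_const, nsmul_eq_mul, mul_comm]
    _ ≤ _ := by
        rw [mul_assoc]
        exact mul_le_mul_of_nonneg_left (card_filter_two_mul_card_image_lt_le hN) hB

omit [DecidableEq ℰ] in
/-- Replacing label moments by sums over matchings costs a negligible error. -/
lemma exists_abs_sum_labelMoment_sub_le {L : Type*} [Fintype L] {lab : L → Finset P}
    (hlab : ∀ x, ∃ ℓ, x ∈ lab ℓ) {C : ℝ} (hC : 1 ≤ C) (src dst : ℰ → P) :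
    ∃ K : ℝ, ∀ N : ℕ, N ≠ 0 → ∀ H : Matrix (Fin N) (Fin N) ℝ, (∀ α β, |H α β| ≤ C) →
      |∑ p, labelMoment lab p * edgeWeight H src dst Finset.univ p -
        ∑ τ ∈ matchings lab, ∑ p ∈ invariantMaps N τ, edgeWeight H src dst Finset.univ p| ≤
      K * (N : ℝ) ^ ((Fintype.card P - 1) / 2) := by
  obtain ⟨B, hB⟩ := exists_abs_labelMoment_le lab
  refine ⟨(|B| + (matchings lab).card) * C ^ Fintype.card ℰ *
    (((Fintype.card P - 1) / 2) ^ Fintype.card P : ℕ), fun N hN H hH => ?_⟩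
  have : ∑ τ ∈ matchings lab, ∑ p ∈ invariantMaps N τ, edgeWeight H src dst Finset.univ p =
      ∑ p, (∑ τ ∈ matchings lab, if ∀ x, p (τ x) = p x then 1 else 0) *
        edgeWeight H src dst Finset.univ p := by
    simp_rw [Finset.sum_mul, ite_mul, one_mul, zero_mul]
    rw [Finset.sum_comm]
    exact Finset.sum_congr rfl fun τ _ => Finset.sum_filter _ _
  rw [this, ← Finset.sum_sub_distrib]
  refine abs_sum_le_of_two_mul_card_image_lt hN (by positivity) _ _ (fun p => ?_) fun p _ hp => ?_
  · rw [← sub_mul, abs_mul]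
    refine mul_le_mul ?_ (abs_edgeWeight_le hC hH _ _ _ _) (abs_nonneg _) (by positivity)
    refine (abs_sub _ _).trans (add_le_add ((hB _ p).trans (le_abs_self B)) ?_)
    refine (Finset.abs_sum_le_sum_abs _ _).trans ?_
    refine (Finset.sum_le_card_nsmul _ _ 1 fun τ _ => ?_).trans (by simp)
    split_ifs <;> simp
  · rw [labelMoment_eq_sum_matchings hlab hp, sub_self]

omit [DecidableEq ℰ] in
/-- Identifying the endpoints of two matched pairs makes the sum negligible. -/
lemma abs_sum_invariantMaps_ite_le {H : Matrix (Fin N) (Fin N) ℝ} {C : ℝ} (hC : 1 ≤ C)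
    (hN : N ≠ 0) (hH : ∀ α β, |H α β| ≤ C) {τ : P → P} (hτ : ∀ x, τ x ≠ x) (src dst : ℰ → P)
    (F : Finset ℰ) {x y : P} (hyx : y ≠ x) (hyτ : y ≠ τ x) :
    |∑ p ∈ invariantMaps N τ, if p x = p y then edgeWeight H src dst F p else 0| ≤
      C ^ Fintype.card ℰ * (((Fintype.card P - 1) / 2) ^ Fintype.card P : ℕ) *
        (N : ℝ) ^ ((Fintype.card P - 1) / 2) := by
  refine abs_sum_le_of_two_mul_card_image_lt hN (by positivity) _ _ (fun p => ?_) fun p hp hle => ?_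
  · split_ifs
    · exact abs_edgeWeight_le hC hH _ _ _ _
    · rw [abs_zero]
      positivity
  · have hp := (Finset.mem_filter.1 hp).2
    refine if_neg fun h => absurd (two_mul_card_image_lt (fun z => ⟨τ z, hp z, hτ z⟩) h.symm (hp x)
      hyx (hτ x) hyτ) (by omega)

end GraphSum

section Ladder

/-- The vertices of `R` pairs of paths with `n` and `m` edges. -/
abbrev PathVertex (n m R : ℕ) : Type := Fin R × (Fin (n + 1) ⊕ Fin (m + 1))

/-- The edges of `R` pairs of paths with `n` and `m` edges. -/
abbrev PathEdge (n m R : ℕ) : Type := Fin R × (Fin n ⊕ Fin m)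

variable {d n m R : ℕ}

/-- The source of an edge. -/
def edgeSrc (e : PathEdge n m R) : PathVertex n m R :=
  (e.1, Sum.map Fin.castSucc Fin.castSucc e.2)

/-- The target of an edge. -/
def edgeDst (e : PathEdge n m R) : PathVertex n m R := (e.1, Sum.map Fin.succ Fin.succ e.2)

/-- The edges at depth at least `s r` in the `r`-th pair of paths. -/
def edgesFrom (s : Fin R → ℕ) : Finset (PathEdge n m R) :=
  {e | s e.1 ≤ Sum.elim Fin.val Fin.val e.2}

/-- The letter at a vertex; the initial vertices of the `r`-th pair of paths carry the extra
letter `r`. -/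
def vertexLetter (u : Fin n → Fin d) (v : Fin m → Fin d) (x : PathVertex n m R) :
    Fin d ⊕ Fin R :=
  Sum.elim (Fin.cases (Sum.inr x.1) fun k => Sum.inl (u k))
    (Fin.cases (Sum.inr x.1) fun k => Sum.inl (v k)) x.2

/-- The vertices carrying a given letter, or, for `none`, the final vertices. -/
def pathLabels (u : Fin n → Fin d) (v : Fin m → Fin d) :
    Option (Fin d ⊕ Fin R) → Finset (PathVertex n m R)
  | none => {x | x.2 = Sum.inl (Fin.last n) ∨ x.2 = Sum.inr (Fin.last m)}
  | some ℓ => {x | vertexLetter u v x = ℓ}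

lemma mem_pathLabels_some {u : Fin n → Fin d} {v : Fin m → Fin d} {ℓ : Fin d ⊕ Fin R}
    {x : PathVertex n m R} : x ∈ pathLabels u v (some ℓ) ↔ vertexLetter u v x = ℓ := by
  simp [pathLabels]

/-- The map `τ` matches corresponding vertices of the paths in each pair from depth `s r` on. -/
def LadderFrom (s : Fin R → ℕ) (τ : PathVertex n m R → PathVertex n m R) : Prop :=
  n = m ∧ ∀ r k (h : k < n + 1) (h' : k < m + 1), s r ≤ k →
    τ (r, Sum.inl ⟨k, h⟩) = (r, Sum.inr ⟨k, h'⟩)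

lemma edgesFrom_eq_insert_insert {s : Fin R → ℕ} {r : Fin R} (h : s r < n) (h' : s r < m) :
    edgesFrom s = insert (r, Sum.inl ⟨s r, h⟩) (insert (r, Sum.inr ⟨s r, h'⟩)
      (edgesFrom (n := n) (m := m) (Function.update s r (s r + 1)))) := by
  ext ⟨r', e⟩
  by_cases hr : r' = r
  · subst hr
    rcases e with k | k <;> simp [edgesFrom, Fin.ext_iff] <;> omega
  · simp [edgesFrom, hr]

lemma eq_of_not_mem_pathLabels_none {u : Fin n → Fin d} {v : Fin m → Fin d}
    {τ : PathVertex n m R → PathVertex n m R} (hτ : τ ∈ matchings (pathLabels u v)) {k : ℕ}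
    {r : Fin R} (h : k < n + 1) (h' : k < m + 1) (hk : ¬ (k < n ∧ k < m))
    (hτk : τ (r, Sum.inl ⟨k, h⟩) = (r, Sum.inr ⟨k, h'⟩)) : n = m ∧ k = n := by
  obtain ⟨-, -, h3⟩ := (Finset.mem_filter.1 hτ).2
  have := h3 none (r, Sum.inl ⟨k, h⟩)
  rw [hτk] at this
  simp only [pathLabels, Finset.mem_filter, Finset.mem_univ, true_and, reduceCtorEq, false_or,
    or_false, Sum.inl.injEq, Sum.inr.injEq, Fin.ext_iff, Fin.val_last] at this
  omega

lemma sum_edgeWeight_edgesFrom {u : Fin n → Fin d} {v : Fin m → Fin d} {C : ℝ} (hC : 1 ≤ C)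
    {N : ℕ} (hN : N ≠ 0) {H : Matrix (Fin N) (Fin N) ℝ} (hH : ∀ α β, |H α β| ≤ C)
    (horth : Hᵀ * H = (N : ℝ) • (1 : Matrix (Fin N) (Fin N) ℝ)) [NeZero R]
    {τ : PathVertex n m R → PathVertex n m R} (hτ : τ ∈ matchings (pathLabels u v))
    (s : Fin R → ℕ) (hs : ∀ r, ∃ (h : s r < n + 1) (h' : s r < m + 1),
      τ (r, Sum.inl ⟨s r, h⟩) = (r, Sum.inr ⟨s r, h'⟩)) :
    (LadderFrom s τ → ∑ p ∈ invariantMaps N τ, edgeWeight H edgeSrc edgeDst (edgesFrom s) p =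
      (invariantMaps N τ).card) ∧
    (¬ LadderFrom s τ →
      |∑ p ∈ invariantMaps N τ, edgeWeight H edgeSrc edgeDst (edgesFrom s) p| ≤
        C ^ Fintype.card (PathEdge n m R) *
          (((Fintype.card (PathVertex n m R) - 1) / 2) ^ Fintype.card (PathVertex n m R) : ℕ) *
          (N : ℝ) ^ ((Fintype.card (PathVertex n m R) - 1) / 2)) := by
  induction hD : ∑ r, (n - s r) using Nat.strong_induction_on generalizing s with
  | _ D ih =>
    obtain ⟨h1, h2, h3⟩ := (Finset.mem_filter.1 hτ).2
    by_cases hex : ∃ r, s r < n ∧ s r < m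
    · obtain ⟨r, hn, hm⟩ := hex
      obtain ⟨h, h', hr⟩ := hs r
      rw [edgesFrom_eq_insert_insert hn hm, sum_edgeWeight_insert_insert hN horth h1
        (by simp) (by simp [edgesFrom]) (by simp [edgesFrom]) (by simpa [edgeSrc] using hr.symm)]
      rotate_left
      · simp only [edgeSrc, edgeDst, Sum.map_inl, Fin.castSucc_mk, Fin.succ_mk, hr]
        simp
      · simp only [edgeSrc, edgeDst, Sum.map_inl, Sum.map_inr, Fin.castSucc_mk, Fin.succ_mk, hr]
        simp
      · rintro ⟨r', e⟩ he
        simp only [edgeSrc, edgeDst, Sum.map_inl, Fin.castSucc_mk, hr]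
        by_cases hrr : r' = r
        · subst hrr
          rcases e with k | k <;> simp [edgesFrom, Fin.ext_iff] at he ⊢ <;> omega
        · simp [hrr]
      by_cases hnext : τ (r, Sum.inl ⟨s r + 1, by omega⟩) = (r, Sum.inr ⟨s r + 1, by omega⟩)
      · have hlad : LadderFrom s τ ↔ LadderFrom (Function.update s r (s r + 1)) τ := by
          refine and_congr_right fun _ => ⟨fun hl r' k hk hk' hle => hl r' k hk hk' ?_,
            fun hl r' k hk hk' hle => ?_⟩
          · rcases eq_or_ne r' r with rfl | hne
            · simp at hle
              omega
            · simpa [hne] using hle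
          · rcases eq_or_ne r' r with rfl | hne
            · rcases hle.eq_or_lt with rfl | hlt
              · exact hr
              · exact hl r' k hk hk' (by simpa using hlt)
            · exact hl r' k hk hk' (by simpa [hne] using hle)
        have hsum : ∀ p ∈ invariantMaps N τ,
            (if p (edgeDst (r, Sum.inl ⟨s r, hn⟩)) = p (edgeDst (r, Sum.inr ⟨s r, hm⟩))
              then edgeWeight H edgeSrc edgeDst
                (edgesFrom (n := n) (m := m) (Function.update s r (s r + 1))) p else 0) =
              edgeWeight H edgeSrc edgeDst (edgesFrom (Function.update s r (s r + 1))) p :=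
          fun p hp => if_pos (by
            have := (Finset.mem_filter.1 hp).2 (r, Sum.inl ⟨s r + 1, by omega⟩)
            rw [hnext] at this
            simpa [edgeDst] using this.symm)
        rw [Finset.sum_congr rfl hsum, hlad]
        refine ih _ ?_ _ (fun r' => ?_) rfl
        · rw [← hD]
          refine Finset.sum_lt_sum (fun r' _ => ?_) ⟨r, Finset.mem_univ _, ?_⟩
          · rcases eq_or_ne r' r with rfl | hne
            · simp only [Function.update_self]
              omega
            · simp [hne]
          · simp only [Function.update_self]
            omega
        · rcases eq_or_ne r' r with rfl | hne
          · simp only [Function.update_self]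
            exact ⟨by omega, by omega, hnext⟩
          · simp only [Function.update_of_ne hne]
            exact hs r'
      · refine ⟨fun hl => absurd (hl.2 r (s r + 1) (by omega) (by omega) (by omega)) hnext,
          fun _ => ?_⟩
        exact abs_sum_invariantMaps_ite_le hC hN hH h2 _ _ _ (by simp [edgeDst])
          (by simpa [edgeDst] using Ne.symm hnext)
    · have hend : ∀ r, n = m ∧ s r = n := fun r => by
        obtain ⟨h, h', hr⟩ := hs r
        exact eq_of_not_mem_pathLabels_none hτ h h' (fun hlt => hex ⟨r, hlt⟩) hr
      have hl : LadderFrom s τ := ⟨(hend 0).1, fun r k hk hk' hle => by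
        obtain ⟨h, h', hr⟩ := hs r
        obtain rfl : s r = k := by have := hend r; omega
        exact hr⟩
      refine ⟨fun _ => ?_, fun hn => absurd hl hn⟩
      have hempty : edgesFrom (n := n) (m := m) s = ∅ := by
        refine Finset.filter_eq_empty_iff.2 ?_
        rintro ⟨r, k | k⟩ - <;> have := hend r <;> simp <;> omega
      simp [hempty, edgeWeight]

lemma matching_zero {u : Fin n → Fin d} {v : Fin m → Fin d}
    {τ : PathVertex n m R → PathVertex n m R} (hτ : τ ∈ matchings (pathLabels u v)) (r : Fin R) :
    τ (r, Sum.inl 0) = (r, Sum.inr 0) := by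
  obtain ⟨-, h2, h3⟩ := (Finset.mem_filter.1 hτ).2
  have hr := (h3 (some (Sum.inr r)) (r, Sum.inl 0)).2 (mem_pathLabels_some.2 rfl)
  have hne := h2 (r, Sum.inl 0)
  revert hr hne
  generalize τ (r, Sum.inl 0) = y
  rcases y with ⟨r', k | k⟩ <;> induction k using Fin.cases <;>
    simp +contextual [mem_pathLabels_some, vertexLetter]

lemma LadderFrom.eq_swap {τ : PathVertex n n R → PathVertex n n R} (hτ : ∀ x, τ (τ x) = x)
    (h : LadderFrom 0 τ) : τ = fun x => (x.1, x.2.swap) := by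
  have hl : ∀ r (k : Fin (n + 1)), τ (r, Sum.inl k) = (r, Sum.inr k) := fun r k =>
    h.2 r k k.2 k.2 (Nat.zero_le _)
  funext x
  obtain ⟨r, k | k⟩ := x
  · exact hl r k
  · have := hτ (r, Sum.inl k)
    rwa [hl] at this

lemma card_invariantMaps_swap (N : ℕ) :
    (invariantMaps N fun x : PathVertex n n R => (x.1, x.2.swap)).card = N ^ (R * (n + 1)) := by
  have : N ^ (R * (n + 1)) = (Finset.univ : Finset (Fin R × Fin (n + 1) → Fin N)).card := by
    simp [Finset.card_univ]
  rw [this]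
  refine Finset.card_nbij' (fun p x => p (x.1, Sum.inl x.2))
    (fun q x => q (x.1, Sum.elim id id x.2)) (fun _ _ => Finset.mem_coe.2 (Finset.mem_univ _))
    (fun q _ => ?_) (fun p hp => ?_) fun q _ => ?_
  · refine Finset.mem_coe.2 (Finset.mem_filter.2 ⟨Finset.mem_univ _, ?_⟩)
    rintro ⟨r, k | k⟩ <;> rfl
  · have hp := (Finset.mem_filter.1 hp).2
    funext x
    obtain ⟨r, k | k⟩ := x
    · rfl
    · exact hp (r, Sum.inr k)
  · rfl

lemma swap_mem_matchings (u : Fin n → Fin d) :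
    (fun x : PathVertex n n R => (x.1, x.2.swap)) ∈ matchings (pathLabels u u) := by
  refine Finset.mem_filter.2 ⟨Finset.mem_univ _, ?_, ?_, ?_⟩
  · simp
  · rintro ⟨r, k | k⟩ <;> simp
  · rintro (_ | ℓ) ⟨r, k | k⟩
    · simp [pathLabels]
    · simp [pathLabels]
    · rw [mem_pathLabels_some, mem_pathLabels_some]
      rfl
    · rw [mem_pathLabels_some, mem_pathLabels_some]
      rfl

lemma LadderFrom.eq_word {I J : List (Fin d)} [NeZero R]
    {τ : PathVertex I.length J.length R → PathVertex I.length J.length R}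
    (hτ : τ ∈ matchings (pathLabels I.get J.get)) (h : LadderFrom 0 τ) : I = J := by
  obtain ⟨-, -, h3⟩ := (Finset.mem_filter.1 hτ).2
  refine List.ext_get h.1 fun k hI hJ => ?_
  have h1 := h.2 0 (k + 1) (by omega) (by omega) (Nat.zero_le _)
  have h2 := h3 (some (Sum.inl (I.get ⟨k, hI⟩))) (0, Sum.inl (Fin.succ ⟨k, hI⟩))
  rw [Fin.succ_mk, h1, ← Fin.succ_mk _ _ hI, ← Fin.succ_mk _ _ hJ] at h2
  simpa [mem_pathLabels_some, vertexLetter, eq_comm] using h2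

/-- The leading order of the moments of the inner product of two word features. -/
lemma exists_abs_sum_labelMoment_sub_wordDelta_le (I J : List (Fin d)) [NeZero R] {C : ℝ}
    (hC : 1 ≤ C) :
    ∃ K : ℝ, ∀ N : ℕ, N ≠ 0 → ∀ H : Matrix (Fin N) (Fin N) ℝ, (∀ α β, |H α β| ≤ C) →
      Hᵀ * H = (N : ℝ) • (1 : Matrix (Fin N) (Fin N) ℝ) →
      |∑ p : PathVertex I.length J.length R → Fin N, labelMoment (pathLabels I.get J.get) p *
          edgeWeight H edgeSrc edgeDst Finset.univ p -
        wordDelta I J * (N : ℝ) ^ (R * (I.length + 1))| ≤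
      K * (N : ℝ) ^ ((R * (I.length + 1 + (J.length + 1)) - 1) / 2) := by
  have hlab : ∀ x, ∃ ℓ, x ∈ pathLabels (R := R) I.get J.get ℓ := fun x =>
    ⟨some (vertexLetter I.get J.get x), mem_pathLabels_some.2 rfl⟩
  have hcard : Fintype.card (PathVertex I.length J.length R) =
      R * (I.length + 1 + (J.length + 1)) := by simp
  obtain ⟨K, hK⟩ := exists_abs_sum_labelMoment_sub_le hlab hC edgeSrc edgeDst
  set M : ℝ := C ^ Fintype.card (PathEdge I.length J.length R) *
    (((Fintype.card (PathVertex I.length J.length R) - 1) / 2) ^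
      Fintype.card (PathVertex I.length J.length R) : ℕ) with hM
  have hM0 : 0 ≤ M := by positivity
  refine ⟨K + (matchings (pathLabels (R := R) I.get J.get)).card * M, fun N hN H hH horth => ?_⟩
  specialize hK N hN H hH
  have huniv : edgesFrom (n := I.length) (m := J.length) (0 : Fin R → ℕ) = Finset.univ := by
    simp [edgesFrom]
  have hmain := fun τ (hτ : τ ∈ matchings (pathLabels (R := R) I.get J.get)) =>
    sum_edgeWeight_edgesFrom hC hN hH horth hτ 0
      fun r => ⟨Nat.succ_pos _, Nat.succ_pos _, matching_zero hτ r⟩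
  rw [huniv, ← hM] at hmain
  rw [hcard] at hK hmain
  have hsum : |∑ τ ∈ matchings (pathLabels (R := R) I.get J.get),
      ∑ p ∈ invariantMaps N τ, edgeWeight H edgeSrc edgeDst Finset.univ p -
        wordDelta I J * (N : ℝ) ^ (R * (I.length + 1))| ≤
      (matchings (pathLabels (R := R) I.get J.get)).card * M *
        (N : ℝ) ^ ((R * (I.length + 1 + (J.length + 1)) - 1) / 2) := by
    by_cases hIJ : I = J
    · subst hIJ
      have hdelta : wordDelta I I * (N : ℝ) ^ (R * (I.length + 1)) =
          ∑ τ ∈ matchings (pathLabels (R := R) I.get I.get),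
            if τ = (fun x => (x.1, x.2.swap)) then (N : ℝ) ^ (R * (I.length + 1)) else 0 := by
        rw [Finset.sum_ite_eq', if_pos (swap_mem_matchings _), wordDelta, if_pos rfl, one_mul]
      rw [hdelta, ← Finset.sum_sub_distrib]
      refine (Finset.abs_sum_le_sum_abs _ _).trans ?_
      rw [mul_assoc, ← nsmul_eq_mul]
      refine Finset.sum_le_card_nsmul _ _ _ fun τ hτ => ?_
      split_ifs with hsw
      · subst hsw
        rw [(hmain _ hτ).1 ⟨rfl, fun r k h h' _ => rfl⟩, card_invariantMaps_swap]
        simp only [Nat.cast_pow, sub_self, abs_zero]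
        positivity
      · rw [sub_zero]
        exact (hmain τ hτ).2 fun hl => hsw (hl.eq_swap (Finset.mem_filter.1 hτ).2.1)
    · rw [wordDelta, if_neg hIJ, zero_mul, sub_zero]
      refine (Finset.abs_sum_le_sum_abs _ _).trans ?_
      rw [mul_assoc, ← nsmul_eq_mul]
      exact Finset.sum_le_card_nsmul _ _ _ fun τ hτ => (hmain τ hτ).2 fun hl => hIJ (hl.eq_word hτ)
  rw [add_mul]
  exact (abs_sub_le _ _ _).trans (add_le_add hK hsum)

end Ladder

section Moments

variable {d N : ℕ}

lemma whFeature_cons (H : Matrix (Fin N) (Fin N) ℝ) (i : Fin d) (I : List (Fin d))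
    (ω : WHOmega d N) (α : Fin N) :
    whFeature H (i :: I) ω α =
      ∑ b, (√(N : ℝ))⁻¹ * H α b * ω.1 i b * whFeature H I ω b := by
  rw [whFeature, wordProd, List.map_cons, List.prod_cons, ← Matrix.mulVec_mulVec, Matrix.mulVec,
    dotProduct]
  refine Finset.sum_congr rfl fun b _ => ?_
  rw [whA, Matrix.smul_apply, Matrix.mul_diagonal, smul_eq_mul, ← mul_assoc]
  rfl

lemma whFeature_eq_sum (H : Matrix (Fin N) (Fin N) ℝ) (I : List (Fin d)) (ω : WHOmega d N)
    (α : Fin N) :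
    whFeature H I ω α = ∑ β : Fin (I.length + 1) → Fin N, if β 0 = α then
      (∏ k : Fin I.length, (√(N : ℝ))⁻¹ * H (β k.castSucc) (β k.succ) * ω.1 (I.get k) (β k.succ)) *
        ω.2 (β (Fin.last _)) else 0 := by
  induction I generalizing α with
  | nil =>
    refine Eq.trans ?_ ((Equiv.funUnique (Fin 1) (Fin N)).symm.sum_comp
      fun β => if β 0 = α then (∏ _k : Fin 0, (1 : ℝ)) * ω.2 (β 0) else 0)
    simp [whFeature, wordProd]
  | cons i I ih =>
    rw [whFeature_cons, ← (Fin.consEquiv fun _ => Fin N).sum_comp, Fintype.sum_prod_type]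
    simp only [Fin.consEquiv_apply, Fin.cons_zero]
    conv_rhs => rw [Finset.sum_eq_single α (fun a _ ha => by simp [ha]) (by simp)]
    simp_rw [ih, Finset.mul_sum]
    rw [Finset.sum_comm]
    refine Finset.sum_congr rfl fun β _ => ?_
    conv_lhs => rw [Finset.sum_eq_single (β 0) (fun a _ ha => by simp [ha.symm]) (by simp)]
    simp only [if_true, List.length_cons]
    rw [Fin.prod_univ_succ, ← mul_assoc]
    rfl

/-- The product of the Gaussian variables along a pair of paths. -/
def pathVars (I J : List (Fin d)) (ω : WHOmega d N)
    (q : Fin (I.length + 1) ⊕ Fin (J.length + 1) → Fin N) : ℝ :=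
  ((∏ k, ω.1 (I.get k) (q (Sum.inl k.succ))) * ω.2 (q (Sum.inl (Fin.last _)))) *
    ((∏ k, ω.1 (J.get k) (q (Sum.inr k.succ))) * ω.2 (q (Sum.inr (Fin.last _))))

/-- The normalised inner product of two word features. -/
def featureInner (H : Matrix (Fin N) (Fin N) ℝ) (I J : List (Fin d)) (ω : WHOmega d N) : ℝ :=
  (N : ℝ)⁻¹ * (whFeature H I ω ⬝ᵥ whFeature H J ω)

lemma featureInner_eq_sum (H : Matrix (Fin N) (Fin N) ℝ) (I J : List (Fin d)) (ω : WHOmega d N) :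
    featureInner H I J ω =
      ∑ q : Fin (I.length + 1) ⊕ Fin (J.length + 1) → Fin N,
        (√(N : ℝ))⁻¹ ^ (I.length + 1 + (J.length + 1)) *
          ((if q (Sum.inl 0) = q (Sum.inr 0) then 1 else 0) *
          ((∏ k : Fin I.length, H (q (Sum.inl k.castSucc)) (q (Sum.inl k.succ))) *
            ∏ k : Fin J.length, H (q (Sum.inr k.castSucc)) (q (Sum.inr k.succ))) *
          pathVars I J ω q) := by
  have hN : (N : ℝ)⁻¹ = (√(N : ℝ))⁻¹ ^ 2 := by rw [inv_pow, Real.sq_sqrt (Nat.cast_nonneg N)]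
  rw [featureInner, dotProduct, ← (Equiv.sumArrowEquivProdArrow _ _ _).symm.sum_comp,
    Fintype.sum_prod_type]
  simp_rw [whFeature_eq_sum, Finset.sum_mul_sum]
  rw [Finset.sum_comm, Finset.mul_sum]
  refine Finset.sum_congr rfl fun β _ => ?_
  rw [Finset.sum_comm, Finset.mul_sum]
  refine Finset.sum_congr rfl fun γ _ => ?_
  simp only [Equiv.sumArrowEquivProdArrow_symm_apply_inl,
    Equiv.sumArrowEquivProdArrow_symm_apply_inr, pathVars, Finset.prod_mul_distrib,
    Finset.prod_const, Finset.card_univ, Fintype.card_fin]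
  rw [Finset.sum_eq_single (β 0) (fun a _ ha => by simp [ha.symm]) (by simp), hN]
  by_cases h : β 0 = γ 0
  · simp only [h, if_true]
    ring
  · simp [h, Ne.symm h]

/-- The monomial in the Gaussian variables with exponents `k` and `l`. -/
def whMonomial (k : Fin d → Fin N → ℕ) (l : Fin N → ℕ) (ω : WHOmega d N) : ℝ :=
  (∏ i, ∏ a, ω.1 i a ^ k i a) * ∏ a, ω.2 a ^ l a

lemma integrable_whMonomial (k : Fin d → Fin N → ℕ) (l : Fin N → ℕ) :
    Integrable (whMonomial k l) (whMeasure d N) :=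
  Integrable.mul_prod
    (Integrable.fintype_prod (f := fun i (x : Fin N → ℝ) => ∏ a, x a ^ k i a) fun i =>
      Integrable.fintype_prod (f := fun a (x : ℝ) => x ^ k i a) fun _ =>
        integrable_pow_gaussianReal _)
    (Integrable.fintype_prod (f := fun a (x : ℝ) => x ^ l a) fun _ =>
      integrable_pow_gaussianReal _)

lemma integral_whMonomial (k : Fin d → Fin N → ℕ) (l : Fin N → ℕ) :
    ∫ ω, whMonomial k l ω ∂(whMeasure d N) =
      (∏ i, ∏ a, gaussMoment (k i a)) * ∏ a, gaussMoment (l a) := by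
  simp only [whMonomial, whMeasure]
  rw [integral_prod_mul (fun x : Fin d → Fin N → ℝ => ∏ i, ∏ a, x i a ^ k i a)
    (fun x : Fin N → ℝ => ∏ a, x a ^ l a),
    integral_fintype_prod_eq_prod (fun i (x : Fin N → ℝ) => ∏ a, x a ^ k i a),
    integral_fintype_prod_eq_prod (fun a (x : ℝ) => x ^ l a)]
  congr 1
  refine Finset.prod_congr rfl fun i _ => ?_
  rw [integral_fintype_prod_eq_prod (fun a (x : ℝ) => x ^ k i a)]
  rfl

lemma prod_comp_eq_prod_pow_card {P A : Type*} [Fintype A] [DecidableEq A] (S : Finset P)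
    (p : P → A) (f : A → ℝ) : ∏ x ∈ S, f (p x) = ∏ a, f a ^ {x ∈ S | p x = a}.card := by
  rw [← Finset.prod_fiberwise' S p f]
  simp

variable {R : ℕ}

lemma prod_pathVars (I J : List (Fin d)) (ω : WHOmega d N)
    (p : PathVertex I.length J.length R → Fin N) :
    ∏ r, pathVars I J ω (fun z => p (r, z)) =
      whMonomial (fun i a => {x ∈ pathLabels I.get J.get (some (Sum.inl i)) | p x = a}.card)
        (fun a => {x ∈ pathLabels I.get J.get none | p x = a}.card) ω := by
  have hletters : ∏ i, ∏ x ∈ pathLabels (R := R) I.get J.get (some (Sum.inl i)), ω.1 i (p x) =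
      ∏ x : PathVertex I.length J.length R,
        Sum.elim (fun i => ω.1 i (p x)) (fun _ => 1) (vertexLetter I.get J.get x) := by
    rw [← Finset.prod_fiberwise Finset.univ (vertexLetter I.get J.get), Fintype.prod_sum_type]
    have h1 : ∀ r : Fin R, ∏ x with vertexLetter I.get J.get x = Sum.inr r,
        Sum.elim (fun i => ω.1 i (p x)) (fun _ => 1) (vertexLetter I.get J.get x) = 1 := fun r =>
      Finset.prod_eq_one fun x hx => by rw [(Finset.mem_filter.1 hx).2]; rfl
    rw [Finset.prod_eq_one fun r _ => h1 r, mul_one]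
    refine Finset.prod_congr rfl fun i _ => Finset.prod_congr rfl fun x hx => ?_
    rw [mem_pathLabels_some.1 hx]
    rfl
  have hends : ∏ x ∈ pathLabels (R := R) I.get J.get none, ω.2 (p x) =
      ∏ r, ω.2 (p (r, Sum.inl (Fin.last _))) * ω.2 (p (r, Sum.inr (Fin.last _))) := by
    simp only [pathLabels, Finset.prod_filter]
    rw [Fintype.prod_prod_type]
    refine Finset.prod_congr rfl fun r _ => ?_
    rw [Fintype.prod_sum_type]
    simp
  simp only [whMonomial, ← prod_comp_eq_prod_pow_card]
  rw [hletters, hends, Fintype.prod_prod_type, ← Finset.prod_mul_distrib]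
  refine Finset.prod_congr rfl fun r _ => ?_
  rw [Fintype.prod_sum_type, Fin.prod_univ_succ, Fin.prod_univ_succ]
  simp only [vertexLetter, Sum.elim_inl, Sum.elim_inr, Fin.cases_zero, Fin.cases_succ, pathVars]
  ring

lemma prod_gaussMoment_initial (I J : List (Fin d)) (r : Fin R)
    (p : PathVertex I.length J.length R → Fin N) :
    ∏ a, gaussMoment {x ∈ pathLabels I.get J.get (some (Sum.inr r)) | p x = a}.card =
      if p (r, Sum.inl 0) = p (r, Sum.inr 0) then 1 else 0 := by
  have hset : pathLabels (R := R) I.get J.get (some (Sum.inr r)) =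
      {(r, Sum.inl 0), (r, Sum.inr 0)} := by
    ext ⟨r', k | k⟩ <;> rw [mem_pathLabels_some] <;> induction k using Fin.cases <;>
      simp [vertexLetter]
  rw [hset]
  split_ifs with h
  · refine Finset.prod_eq_one fun a _ => ?_
    by_cases ha : p (r, Sum.inr 0) = a
    · rw [Finset.filter_true_of_mem (by simp [h, ha]), Finset.card_pair (by simp),
        gaussMoment_two]
    · rw [Finset.filter_false_of_mem (by simp [h, ha]), Finset.card_empty, gaussMoment_zero]
  · refine Finset.prod_eq_zero (Finset.mem_univ (p (r, Sum.inl 0))) ?_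
    rw [Finset.filter_insert, if_pos rfl, Finset.filter_singleton, if_neg (Ne.symm h)]
    simp [gaussMoment_one]

lemma prod_edges (H : Matrix (Fin N) (Fin N) ℝ) {n m : ℕ} (p : PathVertex n m R → Fin N) :
    ∏ r, ((∏ k : Fin n, H (p (r, Sum.inl k.castSucc)) (p (r, Sum.inl k.succ))) *
      ∏ k : Fin m, H (p (r, Sum.inr k.castSucc)) (p (r, Sum.inr k.succ))) =
      edgeWeight H edgeSrc edgeDst Finset.univ p := by
  rw [edgeWeight, Fintype.prod_prod_type]
  refine Finset.prod_congr rfl fun r _ => ?_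
  rw [Fintype.prod_sum_type]
  rfl

lemma featureInner_pow (H : Matrix (Fin N) (Fin N) ℝ) (I J : List (Fin d)) (ω : WHOmega d N) :
    featureInner H I J ω ^ R =
      ∑ p : PathVertex I.length J.length R → Fin N,
        (√(N : ℝ))⁻¹ ^ (R * (I.length + 1 + (J.length + 1))) *
          ((∏ r, if p (r, Sum.inl 0) = p (r, Sum.inr 0) then 1 else 0) *
            edgeWeight H edgeSrc edgeDst Finset.univ p) *
          whMonomial (fun i a => {x ∈ pathLabels I.get J.get (some (Sum.inl i)) | p x = a}.card)
            (fun a => {x ∈ pathLabels I.get J.get none | p x = a}.card) ω := by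
  have hpow : featureInner H I J ω ^ R = ∏ _r : Fin R, featureInner H I J ω := by simp
  rw [hpow]
  simp_rw [featureInner_eq_sum]
  rw [Fintype.prod_sum, ← (Equiv.curry (Fin R) _ (Fin N)).sum_comp]
  refine Finset.sum_congr rfl fun p _ => ?_
  rw [← prod_pathVars, ← prod_edges]
  have hcurry : ∀ r, (Equiv.curry (Fin R) _ (Fin N)) p r = fun z => p (r, z) := fun _ => rfl
  simp only [Finset.prod_mul_distrib, Finset.prod_const, Finset.card_univ, Fintype.card_fin,
    hcurry, ← pow_mul, mul_comm R]
  ring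

lemma integrable_featureInner_pow (H : Matrix (Fin N) (Fin N) ℝ) (I J : List (Fin d)) (R : ℕ) :
    Integrable (fun ω => featureInner H I J ω ^ R) (whMeasure d N) := by
  simp_rw [featureInner_pow]
  exact integrable_finsetSum _ fun p _ => (integrable_whMonomial _ _).const_mul _

lemma integral_featureInner_pow (H : Matrix (Fin N) (Fin N) ℝ) (I J : List (Fin d)) (R : ℕ) :
    ∫ ω, featureInner H I J ω ^ R ∂(whMeasure d N) =
      (√(N : ℝ))⁻¹ ^ (R * (I.length + 1 + (J.length + 1))) *
        ∑ p : PathVertex I.length J.length R → Fin N, labelMoment (pathLabels I.get J.get) p *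
          edgeWeight H edgeSrc edgeDst Finset.univ p := by
  simp_rw [featureInner_pow]
  rw [integral_finsetSum _ fun p _ => (integrable_whMonomial _ _).const_mul _, Finset.mul_sum]
  refine Finset.sum_congr rfl fun p _ => ?_
  rw [integral_const_mul, integral_whMonomial, labelMoment, Fintype.prod_option,
    Fintype.prod_sum_type]
  simp_rw [prod_gaussMoment_initial]
  ring

lemma exists_abs_integral_featureInner_pow_sub_le (I J : List (Fin d)) (R : ℕ) [NeZero R] {C : ℝ}
    (hC : 1 ≤ C) :
    ∃ K : ℝ, ∀ N : ℕ, N ≠ 0 → ∀ H : Matrix (Fin N) (Fin N) ℝ, (∀ α β, |H α β| ≤ C) →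
      Hᵀ * H = (N : ℝ) • (1 : Matrix (Fin N) (Fin N) ℝ) →
      |∫ ω, featureInner H I J ω ^ R ∂(whMeasure d N) - wordDelta I J| ≤ K * (√(N : ℝ))⁻¹ := by
  obtain ⟨K, hK⟩ := exists_abs_sum_labelMoment_sub_wordDelta_le (R := R) I J hC
  refine ⟨|K|, fun N hN H hH horth => ?_⟩
  specialize hK N hN H hH horth
  rw [integral_featureInner_pow]
  set T := R * (I.length + 1 + (J.length + 1)) with hT
  have hT0 : 0 < T := Nat.mul_pos (NeZero.pos R) (by omega)
  set t : ℝ := √(N : ℝ) with ht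
  have hN1 : (1 : ℝ) ≤ N := by exact_mod_cast Nat.one_le_iff_ne_zero.2 hN
  have ht1 : 1 ≤ t := Real.one_le_sqrt.2 hN1
  have ht0 : 0 < t := by linarith
  have hNt : (N : ℝ) = t ^ 2 := (Real.sq_sqrt (Nat.cast_nonneg N)).symm
  have hdelta : wordDelta I J = t⁻¹ ^ T * (wordDelta I J * (N : ℝ) ^ (R * (I.length + 1))) := by
    by_cases h : I = J
    · subst h
      have : T = 2 * (R * (I.length + 1)) := by rw [hT]; ring
      rw [hNt, ← pow_mul, ← this, mul_left_comm, ← mul_pow, inv_mul_cancel₀ ht0.ne', one_pow,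
        mul_one]
    · simp [wordDelta, h]
  rw [hdelta, ← mul_sub, abs_mul, abs_of_nonneg (by positivity)]
  calc _ ≤ t⁻¹ ^ T * (K * (N : ℝ) ^ ((T - 1) / 2)) := by gcongr
    _ ≤ t⁻¹ ^ T * (|K| * t ^ (T - 1)) := by
        rw [hNt, ← pow_mul]
        gcongr
        · exact le_abs_self K
        · omega
    _ = |K| * t⁻¹ := by
        obtain ⟨T', hT'⟩ : ∃ T', T = T' + 1 := ⟨T - 1, by omega⟩
        rw [hT', Nat.add_sub_cancel, pow_succ, inv_pow]
        field_simp

instance : IsProbabilityMeasure (whMeasure d N) := by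
  unfold whMeasure
  infer_instance

lemma exists_measure_abs_featureInner_sub_le (I J : List (Fin d)) {C ε : ℝ} (hC : 1 ≤ C)
    (hε : 0 < ε) :
    ∃ K : ℝ, 0 ≤ K ∧ ∀ N : ℕ, N ≠ 0 → ∀ H : Matrix (Fin N) (Fin N) ℝ, (∀ α β, |H α β| ≤ C) →
      Hᵀ * H = (N : ℝ) • (1 : Matrix (Fin N) (Fin N) ℝ) →
      (whMeasure d N).real {ω | ε < |featureInner H I J ω - wordDelta I J|} ≤
        K * (√(N : ℝ))⁻¹ := by
  obtain ⟨K₁, hK₁⟩ := exists_abs_integral_featureInner_pow_sub_le I J 1 hC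
  obtain ⟨K₂, hK₂⟩ := exists_abs_integral_featureInner_pow_sub_le I J 2 hC
  refine ⟨(|K₂| + 2 * |K₁|) / ε ^ 2, by positivity, fun N hN H hH horth => ?_⟩
  specialize hK₁ N hN H hH horth
  specialize hK₂ N hN H hH horth
  set D := wordDelta I J with hD
  have hD2 : D ^ 2 = D ∧ 0 ≤ D ∧ D ≤ 1 := by
    rw [hD, wordDelta]
    split_ifs <;> norm_num
  have hi1 : Integrable (fun ω => featureInner H I J ω) (whMeasure d N) := by
    simpa using integrable_featureInner_pow H I J 1
  have hi2 := integrable_featureInner_pow H I J 2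
  have hexp : (fun ω => (featureInner H I J ω - D) ^ 2) =
      fun ω => featureInner H I J ω ^ 2 - 2 * D * featureInner H I J ω + D := by
    funext ω
    rw [sub_sq, hD2.1]
    ring
  have hi : Integrable (fun ω => (featureInner H I J ω - D) ^ 2) (whMeasure d N) := by
    rw [hexp]
    exact (hi2.sub (hi1.const_mul _)).add (integrable_const _)
  have hint : ∫ ω, (featureInner H I J ω - D) ^ 2 ∂(whMeasure d N) ≤
      (|K₂| + 2 * |K₁|) * (√(N : ℝ))⁻¹ := by
    have hi3 : Integrable (fun ω => featureInner H I J ω ^ 2 - 2 * D * featureInner H I J ω)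
        (whMeasure d N) := hi2.sub (hi1.const_mul _)
    rw [hexp, integral_add hi3 (integrable_const _),
      integral_sub hi2 (hi1.const_mul _), integral_const_mul]
    simp only [pow_one] at hK₁
    simp only [integral_const, probReal_univ, smul_eq_mul, one_mul]
    set s := (√(N : ℝ))⁻¹
    have hs : 0 ≤ s := by positivity
    have h1 := abs_le.1 (hK₁.trans (mul_le_mul_of_nonneg_right (le_abs_self K₁) hs))
    have h2 := abs_le.1 (hK₂.trans (mul_le_mul_of_nonneg_right (le_abs_self K₂) hs))
    have h3 := abs_nonneg K₁
    nlinarith [mul_nonneg h3 hs]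
  have hmarkov := mul_meas_ge_le_integral_of_nonneg
    (Filter.Eventually.of_forall fun ω => sq_nonneg (featureInner H I J ω - D)) hi (ε ^ 2)
  have hsub : (whMeasure d N).real {ω | ε < |featureInner H I J ω - D|} ≤
      (whMeasure d N).real {ω | ε ^ 2 ≤ (featureInner H I J ω - D) ^ 2} :=
    measureReal_mono (fun ω hω => by
      rw [Set.mem_ofPred_eq, ← sq_abs (featureInner H I J ω - D)]
      exact pow_le_pow_left₀ hε.le (le_of_lt hω) 2) (measure_ne_top _ _)
  rw [div_mul_eq_mul_div, le_div_iff₀ (by positivity), mul_comm]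
  exact (mul_le_mul_of_nonneg_left hsub (by positivity)).trans (hmarkov.trans hint)

end Moments

/-- **High-probability almost-orthonormality for the Walsh–Hadamard model.**
Fix `d ≥ 1` and `C ≥ 1`.  For every `ε, δ ∈ (0,1)` and every finite set `𝒲` of words
over `{1,…,d}` there is an `N₀` such that for all `N ≥ N₀` and every
`H ∈ ℝ^{N×N}` with `H Hᵀ = N⬝I_N` and entries bounded in absolute value by `C`,
`P(|(1/N)⟨A_I h₀, A_J h₀⟩ - δ_{I,J}| ≤ ε for all I, J ∈ 𝒲) ≥ 1 - δ`. -/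
theorem walsh_hadamard_high_probability_orthonormality (d : ℕ) (hd : 1 ≤ d)
    (C : ℝ) (hC : 1 ≤ C)
    (ε δ : ℝ) (hε : ε ∈ Set.Ioo (0 : ℝ) 1) (hδ : δ ∈ Set.Ioo (0 : ℝ) 1)
    (𝒲 : Finset (List (Fin d))) :
    ∃ N₀ : ℕ, ∀ N : ℕ, N₀ ≤ N →
      ∀ H : Matrix (Fin N) (Fin N) ℝ,
        H * Hᵀ = (N : ℝ) • (1 : Matrix (Fin N) (Fin N) ℝ) →
        (∀ α β, |H α β| ≤ C) →
        whMeasure d N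
            {ω | ∀ I ∈ 𝒲, ∀ J ∈ 𝒲,
              |((N : ℕ) : ℝ)⁻¹ * (whFeature H I ω ⬝ᵥ whFeature H J ω)
                - wordDelta I J| ≤ ε}
          ≥ ENNReal.ofReal (1 - δ) := by
  obtain ⟨hε0, -⟩ := hε
  obtain ⟨hδ0, -⟩ := hδ
  choose K hK0 hK using fun IJ : List (Fin d) × List (Fin d) =>
    exists_measure_abs_featureInner_sub_le IJ.1 IJ.2 hC hε0
  set T := ∑ IJ ∈ 𝒲 ×ˢ 𝒲, K IJ with hT
  have hT0 : 0 ≤ T := Finset.sum_nonneg fun IJ _ => hK0 IJ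
  refine ⟨⌈(T / δ) ^ 2⌉₊ + 1, fun N hN H hH hHC => ?_⟩
  have hN0 : N ≠ 0 := by omega
  have hN' : (N : ℝ) ≠ 0 := Nat.cast_ne_zero.2 hN0
  have horth : Hᵀ * H = (N : ℝ) • (1 : Matrix (Fin N) (Fin N) ℝ) := by
    have h1 : H * ((N : ℝ)⁻¹ • Hᵀ) = 1 := by
      rw [Matrix.mul_smul, hH, smul_smul, inv_mul_cancel₀ hN', one_smul]
    have h2 := mul_eq_one_comm.1 h1
    rw [← h2, Matrix.smul_mul, smul_smul, mul_inv_cancel₀ hN', one_smul]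
  have hsqrt : T * (√(N : ℝ))⁻¹ ≤ δ := by
    have h1 : (T / δ) ^ 2 ≤ N := (Nat.le_ceil _).trans (by exact_mod_cast (by omega))
    have h2 : T / δ ≤ √(N : ℝ) := Real.le_sqrt_of_sq_le h1
    rw [← div_eq_mul_inv, div_le_iff₀ (by positivity), mul_comm]
    exact (div_le_iff₀ hδ0).1 h2
  set S := {ω : WHOmega d N | ∀ I ∈ 𝒲, ∀ J ∈ 𝒲,
    |((N : ℕ) : ℝ)⁻¹ * (whFeature H I ω ⬝ᵥ whFeature H J ω) - wordDelta I J| ≤ ε} with hS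
  have hcompl : (whMeasure d N).real Sᶜ ≤ δ := by
    have hsub : Sᶜ ⊆ ⋃ IJ ∈ 𝒲 ×ˢ 𝒲,
        {ω : WHOmega d N | ε < |featureInner H IJ.1 IJ.2 ω - wordDelta IJ.1 IJ.2|} := by
      intro ω hω
      simp only [hS, Set.mem_compl_iff, Set.mem_ofPred_eq] at hω
      push Not at hω
      obtain ⟨I, hI, J, hJ, h⟩ := hω
      exact Set.mem_biUnion (x := (I, J)) (Finset.mem_coe.2 (Finset.mk_mem_product hI hJ)) h
    calc _ ≤ _ := measureReal_mono hsub (measure_ne_top _ _)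
      _ ≤ ∑ IJ ∈ 𝒲 ×ˢ 𝒲, (whMeasure d N).real
          {ω | ε < |featureInner H IJ.1 IJ.2 ω - wordDelta IJ.1 IJ.2|} :=
        measureReal_biUnion_finset_le _ _
      _ ≤ ∑ IJ ∈ 𝒲 ×ˢ 𝒲, K IJ * (√(N : ℝ))⁻¹ :=
        Finset.sum_le_sum fun IJ _ => hK IJ N hN0 H hHC horth
      _ ≤ δ := by rwa [← Finset.sum_mul]
  have hone : 1 ≤ (whMeasure d N).real S + (whMeasure d N).real Sᶜ := by
    have := measureReal_union_le (μ := whMeasure d N) S Sᶜ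
    rwa [Set.union_compl_self, probReal_univ] at this
  rw [ge_iff_le, ← ofReal_measureReal]
  exact ENNReal.ofReal_le_ofReal (by linarith)

end
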